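/- arXiv:1804.01360 — 2 statements merged into one kernel-verified Lean document; each statement's English description precedes it below -/
import Mathlib

section
/- Let p > 3 be prime. Every regular subgroup G of Hol(M₁) with |Θ(G)| = p³ is isomorphic to M₁; there are exactly (p² − 1)p³ such regular subgroups; and the conjugation action of Aut(M₁) on the set of such subgroups has exactly 4 orbits, with representatives ⟨τ^{−2}α₁, ρ^{s}τα₂, σ²τ^{t}α₃⟩ for t ∈ {0, 1} and s ∈ {1, δ}, where δ is a fixed non-square in 𝔽_p^×. -/
/-! ## The Heisenberg group of order `p³` -/

@[ext]
structure Heisenberg (p : ℕ) where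
  x : ZMod p
  y : ZMod p
  z : ZMod p

namespace Heisenberg

variable {p : ℕ}

instance : Mul (Heisenberg p) :=
  ⟨fun g h => ⟨g.x + h.x, g.y + h.y, g.z + h.z + h.x * g.y⟩⟩

instance : One (Heisenberg p) := ⟨⟨0, 0, 0⟩⟩

instance : Inv (Heisenberg p) := ⟨fun g => ⟨-g.x, -g.y, -g.z + g.x * g.y⟩⟩

@[simp] theorem mul_x (g h : Heisenberg p) : (g * h).x = g.x + h.x := rfl
@[simp] theorem mul_y (g h : Heisenberg p) : (g * h).y = g.y + h.y := rfl
@[simp] theorem mul_z (g h : Heisenberg p) : (g * h).z = g.z + h.z + h.x * g.y := rfl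
@[simp] theorem one_x : (1 : Heisenberg p).x = 0 := rfl
@[simp] theorem one_y : (1 : Heisenberg p).y = 0 := rfl
@[simp] theorem one_z : (1 : Heisenberg p).z = 0 := rfl
@[simp] theorem inv_x (g : Heisenberg p) : (g⁻¹).x = -g.x := rfl
@[simp] theorem inv_y (g : Heisenberg p) : (g⁻¹).y = -g.y := rfl
@[simp] theorem inv_z (g : Heisenberg p) : (g⁻¹).z = -g.z + g.x * g.y := rfl

instance : Group (Heisenberg p) where
  mul_assoc a b c := by ext <;> simp <;> ring
  one_mul a := by ext <;> simp
  mul_one a := by ext <;> simp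
  inv_mul_cancel a := by ext <;> simp <;> ring

/-- The generator `ρ` (a generator of the centre). -/
def ρ : Heisenberg p := ⟨0, 0, 1⟩

/-- The generator `σ`. -/
def σ : Heisenberg p := ⟨1, 0, 0⟩

/-- The generator `τ`. -/
def τ : Heisenberg p := ⟨0, 1, 0⟩

/-- The automorphism `α₁` determined by `σ ↦ ρσ`, `τ ↦ τ` (and `ρ ↦ ρ`). -/
def α₁ : MulAut (Heisenberg p) where
  toFun g := ⟨g.x, g.y, g.z + g.x⟩
  invFun g := ⟨g.x, g.y, g.z - g.x⟩
  left_inv g := by ext <;> simp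
  right_inv g := by ext <;> simp
  map_mul' g h := by ext <;> simp <;> ring

/-- The automorphism `α₃` determined by `σ ↦ σ`, `τ ↦ ρτ` (and `ρ ↦ ρ`). -/
def α₃ : MulAut (Heisenberg p) where
  toFun g := ⟨g.x, g.y, g.z + g.y⟩
  invFun g := ⟨g.x, g.y, g.z - g.y⟩
  left_inv g := by ext <;> simp
  right_inv g := by ext <;> simp
  map_mul' g h := by ext <;> simp <;> ring

/-- The automorphism `α₂` determined by `σ ↦ στ`, `τ ↦ τ` (and `ρ ↦ ρ`), for `p` an odd
prime. -/
def α₂ (p : ℕ) [Fact p.Prime] (hp : p ≠ 2) : MulAut (Heisenberg p) where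
  toFun g := ⟨g.x, g.x + g.y, g.z + g.x * (g.x - 1) / 2⟩
  invFun g := ⟨g.x, g.y - g.x, g.z - g.x * (g.x - 1) / 2⟩
  left_inv g := by ext <;> simp <;> ring
  right_inv g := by ext <;> simp <;> ring
  map_mul' g h := by
    have h2 : (2 : ZMod p) ≠ 0 := by
      intro h
      have h' : ((2 : ℕ) : ZMod p) = 0 := by exact_mod_cast h
      rw [CharP.cast_eq_zero_iff (ZMod p) p 2] at h'
      have h1 := Nat.le_of_dvd (by norm_num) h'
      have h2 := (Fact.out : p.Prime).two_le
      omega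
    ext <;> simp
    · ring
    · field_simp
      ring

end Heisenberg

open Heisenberg

/-! ## The holomorph of `M₁` inside the permutation group -/

/-- The left regular representation `M₁ → Perm M₁`. -/
def leftMulHom (p : ℕ) : Heisenberg p →* Equiv.Perm (Heisenberg p) :=
  MulAction.toPermHom (Heisenberg p) (Heisenberg p)

/-- The holomorph of `M₁`, realized as the subgroup of `Perm M₁` generated by left
translations and automorphisms of `M₁`. -/
def Hol (p : ℕ) : Subgroup (Equiv.Perm (Heisenberg p)) :=
  (leftMulHom p).range ⊔
    (MulAut.toPerm (Heisenberg p)).range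

/-- A subgroup of `Perm X` is regular if it acts freely and transitively on `X`. -/
def IsRegularSub {X : Type*} (H : Subgroup (Equiv.Perm X)) : Prop :=
  ∀ x y : X, ∃! g : Equiv.Perm X, g ∈ H ∧ g x = y

/-- The canonical projection `Θ : Hol(M₁) → Aut(M₁)` (with kernel the left translations),
written as a function on permutations: it sends `π` to `m ↦ (π 1)⁻¹ * π m`; on elements of the
holomorph, this is exactly the automorphism component. -/
def theta (p : ℕ) (π : Equiv.Perm (Heisenberg p)) : Equiv.Perm (Heisenberg p) :=
  (Equiv.mulLeft (π 1))⁻¹ * π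

/-- The cardinality of the image `Θ(G)` of a subgroup `G` of the holomorph under the canonical
projection `Θ`. -/
noncomputable def thetaCard (p : ℕ) (G : Subgroup (Equiv.Perm (Heisenberg p))) : ℕ :=
  Nat.card (theta p '' (G : Set (Equiv.Perm (Heisenberg p))))

/-- The conjugation action of `Aut(M₁)` (viewed inside `Perm M₁`) on subgroups of `Perm M₁`. -/
def autConj (p : ℕ) (α : MulAut (Heisenberg p)) (G : Subgroup (Equiv.Perm (Heisenberg p))) :
    Subgroup (Equiv.Perm (Heisenberg p)) :=
  Subgroup.map (MulAut.conj (MulAut.toPerm (Heisenberg p) α)).toMonoidHom G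


/-- `G` is a regular subgroup of `Hol(M₁)` with `|Θ(G)| = p³`. -/
def cond16 (p : ℕ) (G : Subgroup (Equiv.Perm (Heisenberg p))) : Prop :=
  G ≤ Hol p ∧ IsRegularSub G ∧ thetaCard p G = p ^ 3

/-- The representative `⟨τ⁻²α₁, ρˢτα₂, σ²τᵗα₃⟩` of `Hol(M₁)`. -/
def rep16 (p : ℕ) [Fact p.Prime] (hp : p ≠ 2) (s : ZMod p) (t : ℕ) :
    Subgroup (Equiv.Perm (Heisenberg p)) :=
  Subgroup.closure {leftMulHom p (τ ^ 2)⁻¹ * MulAut.toPerm (Heisenberg p) α₁,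
    leftMulHom p (ρ ^ s.val * τ) * MulAut.toPerm (Heisenberg p) (α₂ p hp),
    leftMulHom p (σ ^ 2 * τ ^ t) * MulAut.toPerm (Heisenberg p) α₃}

/-! ## Quadratic coordinates on the holomorph -/

namespace Heisenberg

variable {p : ℕ}

/-- The inverse of `2` modulo `p`. -/
def half (p : ℕ) : ZMod p := 2⁻¹

theorem two_ne_zero_of_ne_two [Fact p.Prime] (hp : p ≠ 2) : (2 : ZMod p) ≠ 0 := by
  intro h
  have h' : ((2 : ℕ) : ZMod p) = 0 := by exact_mod_cast h
  rw [CharP.cast_eq_zero_iff (ZMod p) p 2] at h'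
  exact hp ((Nat.prime_dvd_prime_iff_eq Fact.out Nat.prime_two).1 h')

theorem two_mul_half [Fact p.Prime] (hp : p ≠ 2) : 2 * half p = 1 :=
  mul_inv_cancel₀ (two_ne_zero_of_ne_two hp)

/-- The equivalence with triples of residues. -/
def equivProd (p : ℕ) : Heisenberg p ≃ ZMod p × ZMod p × ZMod p where
  toFun g := (g.x, g.y, g.z)
  invFun t := ⟨t.1, t.2.1, t.2.2⟩

instance [Fact p.Prime] : Finite (Heisenberg p) := Finite.of_equiv _ (equivProd p).symm

theorem card_eq [Fact p.Prime] : Nat.card (Heisenberg p) = p ^ 3 := by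
  rw [Nat.card_congr (equivProd p), Nat.card_prod, Nat.card_prod, Nat.card_zmod]
  ring

theorem eq_map_one_mul {f : ZMod p → ZMod p} (hf : ∀ s t, f (s + t) = f s + f t) (t : ZMod p) :
    f t = f 1 * t := by
  have := ((AddMonoidHom.mk' f hf).toZModLinearMap p).map_smul t 1
  simpa [mul_comm] using this

theorem pow_eq_of_mul_eq_zero (g : Heisenberg p) (h : g.x * g.y = 0) (n : ℕ) :
    g ^ n = ⟨n * g.x, n * g.y, n * g.z⟩ := by
  induction n with
  | zero => ext <;> simp
  | succ n ih =>
    rw [pow_succ, ih]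
    ext <;> simp
    · ring
    · ring
    · linear_combination (n : ZMod p) * h

/-- The coefficients of the self-map of the Heisenberg group that is
`(u, w) ↦ (B u + v, det B * w + w₀ + m u)` in the coordinates `u = (x, y)`, `w = z - x y / 2`. -/
@[ext]
structure AffineData (p : ℕ) where
  a : ZMod p
  b : ZMod p
  c : ZMod p
  d : ZMod p
  v₁ : ZMod p
  v₂ : ZMod p
  w : ZMod p
  m₁ : ZMod p
  m₂ : ZMod p

namespace AffineData

/-- The determinant of the linear part. -/
def det (A : AffineData p) : ZMod p := A.a * A.d - A.b * A.c

/-- The matrix of the linear part. -/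
def matrix (A : AffineData p) : Matrix (Fin 2) (Fin 2) (ZMod p) := !![A.a, A.b; A.c, A.d]

/-- The map with given coefficients. -/
def toFun (A : AffineData p) (g : Heisenberg p) : Heisenberg p :=
  ⟨A.a * g.x + A.b * g.y + A.v₁, A.c * g.x + A.d * g.y + A.v₂,
    half p * (A.a * g.x + A.b * g.y + A.v₁) * (A.c * g.x + A.d * g.y + A.v₂)
      + (A.a * A.d - A.b * A.c) * (g.z - half p * g.x * g.y) + A.w + A.m₁ * g.x + A.m₂ * g.y⟩

/-- The coefficients of a composite. -/
def comp (A B : AffineData p) : AffineData p where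
  a := A.a * B.a + A.b * B.c
  b := A.a * B.b + A.b * B.d
  c := A.c * B.a + A.d * B.c
  d := A.c * B.b + A.d * B.d
  v₁ := A.a * B.v₁ + A.b * B.v₂ + A.v₁
  v₂ := A.c * B.v₁ + A.d * B.v₂ + A.v₂
  w := (A.a * A.d - A.b * A.c) * B.w + A.w + A.m₁ * B.v₁ + A.m₂ * B.v₂
  m₁ := (A.a * A.d - A.b * A.c) * B.m₁ + A.m₁ * B.a + A.m₂ * B.c
  m₂ := (A.a * A.d - A.b * A.c) * B.m₂ + A.m₁ * B.b + A.m₂ * B.d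

/-- The coefficients of the identity. -/
def id (p : ℕ) : AffineData p := ⟨1, 0, 0, 1, 0, 0, 0, 0, 0⟩

/-- The coefficients of the inverse. -/
def inv (A : AffineData p) : AffineData p where
  a := A.det⁻¹ * A.d
  b := -A.det⁻¹ * A.b
  c := -A.det⁻¹ * A.c
  d := A.det⁻¹ * A.a
  v₁ := -A.det⁻¹ * (A.d * A.v₁ - A.b * A.v₂)
  v₂ := -A.det⁻¹ * (A.a * A.v₂ - A.c * A.v₁)
  w := -A.det⁻¹ * A.w + A.det⁻¹ ^ 2 *
    ((A.m₁ * A.d - A.m₂ * A.c) * A.v₁ + (A.m₂ * A.a - A.m₁ * A.b) * A.v₂)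
  m₁ := -A.det⁻¹ ^ 2 * (A.m₁ * A.d - A.m₂ * A.c)
  m₂ := -A.det⁻¹ ^ 2 * (A.m₂ * A.a - A.m₁ * A.b)

theorem toFun_comp (A B : AffineData p) : (A.comp B).toFun = A.toFun ∘ B.toFun := by
  funext g
  ext <;> simp only [toFun, comp, Function.comp_apply] <;> ring

theorem toFun_id : (id p).toFun = _root_.id := by
  funext g
  ext <;> simp [toFun, id]

theorem toFun_injective : Function.Injective (toFun : AffineData p → _) := by
  intro A B h
  have h0 := congrFun h ⟨0, 0, 0⟩
  have h1 := congrFun h ⟨1, 0, 0⟩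
  have h2 := congrFun h ⟨0, 1, 0⟩
  simp only [toFun, Heisenberg.mk.injEq, mul_zero, mul_one, zero_add, add_zero, sub_zero] at h0 h1 h2
  obtain ⟨e1, e2, e3⟩ := h0
  obtain ⟨e4, e5, e6⟩ := h1
  obtain ⟨e7, e8, e9⟩ := h2
  rw [e1, e2, add_left_cancel_iff] at e3
  rw [e4, e5, e3, add_right_inj] at e6
  rw [e7, e8, e3, add_right_inj] at e9
  rw [e1, add_left_inj] at e4 e7
  rw [e2, add_left_inj] at e5 e8
  ext <;> assumption

theorem matrix_comp (A B : AffineData p) : (A.comp B).matrix = A.matrix * B.matrix := by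
  simp [matrix, comp]

theorem det_comp (A B : AffineData p) : (A.comp B).det = A.det * B.det := by
  simp only [det, comp]
  ring

variable [Fact p.Prime]

theorem det_inv_mul {A : AffineData p} (hA : A.det ≠ 0) :
    A.det⁻¹ * (A.a * A.d - A.b * A.c) = 1 := inv_mul_cancel₀ hA

theorem inv_comp {A : AffineData p} (hA : A.det ≠ 0) : A.inv.comp A = id p := by
  have h := det_inv_mul hA
  ext <;> simp only [comp, inv, id] <;> generalize A.det⁻¹ = D at * <;> grind

theorem comp_inv {A : AffineData p} (hA : A.det ≠ 0) : A.comp A.inv = id p := by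
  have h := det_inv_mul hA
  ext <;> simp only [comp, inv, id] <;> generalize A.det⁻¹ = D at * <;> grind

theorem det_inv_ne_zero {A : AffineData p} (hA : A.det ≠ 0) : A.inv.det ≠ 0 := by
  intro h
  have := det_comp A.inv A
  rw [inv_comp hA, h, zero_mul] at this
  simp [det, id] at this

/-- The permutation with given coefficients. -/
def toPerm (A : AffineData p) (hA : A.det ≠ 0) : Equiv.Perm (Heisenberg p) where
  toFun := A.toFun
  invFun := A.inv.toFun
  left_inv := Function.leftInverse_iff_comp.2 (by rw [← toFun_comp, inv_comp hA, toFun_id])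
  right_inv := Function.rightInverse_iff_comp.2 (by rw [← toFun_comp, comp_inv hA, toFun_id])

/-- The automorphism with given coefficients, when the translation part is trivial. -/
def toMulAut (A : AffineData p) (hp : p ≠ 2) (hA : A.det ≠ 0)
    (h₁ : A.v₁ = 0) (h₂ : A.v₂ = 0) (h₃ : A.w = 0) : MulAut (Heisenberg p) where
  toEquiv := A.toPerm hA
  map_mul' g h := by
    have := two_mul_half hp
    ext <;> simp [toPerm, toFun, h₁, h₂, h₃]
    · ring
    · ring
    · generalize half p = t at *
      grind

end AffineData

open AffineData

theorem mul_eq_comp {π π' : Equiv.Perm (Heisenberg p)} {A A' : AffineData p}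
    (h : ⇑π = A.toFun) (h' : ⇑π' = A'.toFun) : ⇑(π * π') = (A.comp A').toFun := by
  rw [Equiv.Perm.coe_mul, h, h', toFun_comp]

theorem leftMulHom_eq_toFun [Fact p.Prime] (hp : p ≠ 2) (g : Heisenberg p) :
    ⇑(leftMulHom p g) = (⟨1, 0, 0, 1, g.x, g.y, g.z - half p * g.x * g.y, half p * g.y,
      -half p * g.x⟩ : AffineData p).toFun := by
  funext h
  have := two_mul_half hp
  change g * h = _
  ext <;> simp [toFun]
  · ring
  · ring
  · generalize half p = t at *
    linear_combination -(h.x * g.y) * this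

theorem eq_of_map_add [Fact p.Prime] (hp : p ≠ 2) {f : ZMod p → Heisenberg p}
    (hf : ∀ s t, f (s + t) = f s * f t) :
    ∃ a b c, ∀ t, f t = ⟨a * t, b * t, c * t + half p * (a * t) * (b * t)⟩ := by
  have h2 := two_mul_half hp
  have hx := eq_map_one_mul (f := fun t => (f t).x) fun s t => by simp [hf]
  have hy := eq_map_one_mul (f := fun t => (f t).y) fun s t => by simp [hf]
  have hz := eq_map_one_mul (f := fun t => (f t).z - half p * (f t).x * (f t).y) fun s t => by
    have e1 := hx s
    have e2 := hy s
    have e3 := hx t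
    have e4 := hy t
    simp only [hf, mul_x, mul_y, mul_z, e1, e2, e3, e4]
    linear_combination -(f 1).x * (f 1).y * s * t * h2
  refine ⟨(f 1).x, (f 1).y, (f 1).z - half p * (f 1).x * (f 1).y, fun t => ?_⟩
  ext
  · exact hx t
  · exact hy t
  · have e1 := hx t
    have e2 := hy t
    have e3 := hz t
    simp only at e3 ⊢
    rw [← e3, ← e1, ← e2]
    ring

theorem exists_eq_toFun [Fact p.Prime] (hp : p ≠ 2) (φ : MulAut (Heisenberg p)) :
    ∃ A : AffineData p, A.v₁ = 0 ∧ A.v₂ = 0 ∧ A.w = 0 ∧ A.det ≠ 0 ∧ ⇑φ = A.toFun := by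
  obtain ⟨a, c, e, h1⟩ := eq_of_map_add hp (f := fun t => φ ⟨t, 0, 0⟩) fun s t => by
    rw [← map_mul]; congr 1; ext <;> simp
  obtain ⟨b, d, f, h2⟩ := eq_of_map_add hp (f := fun t => φ ⟨0, t, 0⟩) fun s t => by
    rw [← map_mul]; congr 1; ext <;> simp
  obtain ⟨k, l, D, h3⟩ := eq_of_map_add hp (f := fun t => φ ⟨0, 0, t⟩) fun s t => by
    rw [← map_mul]; congr 1; ext <;> simp
  have hdecomp (g : Heisenberg p) : φ g = φ ⟨g.x, 0, 0⟩ * φ ⟨0, g.y, 0⟩ * φ ⟨0, 0, g.z⟩ := by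
    rw [← map_mul, ← map_mul]; congr 1; ext <;> simp
  have hcomm : φ ⟨0, 1, 0⟩ * φ ⟨1, 0, 0⟩ = φ ⟨1, 0, 0⟩ * φ ⟨0, 1, 0⟩ * φ ⟨0, 0, 1⟩ := by
    rw [← map_mul, ← map_mul, ← map_mul]; congr 1; ext <;> simp
  have half2 := two_mul_half hp
  rw [h1, h2, h3, Heisenberg.ext_iff] at hcomm
  simp only [mul_x, mul_y, mul_z, mul_one] at hcomm
  obtain ⟨q1, q2, q3⟩ := hcomm
  have hk : k = 0 := by linear_combination -q1
  have hl : l = 0 := by linear_combination -q2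
  subst hk hl
  have hD : D = a * d - b * c := by linear_combination -q3
  subst hD
  refine ⟨⟨a, b, c, d, 0, 0, 0, e, f⟩, rfl, rfl, rfl, fun h => ?_, ?_⟩
  · simp only [AffineData.det] at h
    have h31 := h3 1
    rw [h] at h31
    have : (⟨0, 0, 1⟩ : Heisenberg p) = 1 := φ.injective (by rw [map_one, h31]; ext <;> simp)
    exact one_ne_zero (congrArg Heisenberg.z this)
  · funext g
    rw [hdecomp, h1, h2, h3]
    ext <;> simp [toFun]
    generalize half p = t at *
    linear_combination -(b * c * g.x * g.y) * half2

/-- The subgroup of permutations described by affine data of nonzero determinant. -/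
def affineSubgroup (p : ℕ) [Fact p.Prime] : Subgroup (Equiv.Perm (Heisenberg p)) where
  carrier := {π | ∃ A : AffineData p, A.det ≠ 0 ∧ ⇑π = A.toFun}
  mul_mem' := by
    rintro π π' ⟨A, hA, h⟩ ⟨A', hA', h'⟩
    exact ⟨A.comp A', by rw [det_comp]; exact mul_ne_zero hA hA', mul_eq_comp h h'⟩
  one_mem' := ⟨AffineData.id p, by simp [AffineData.det, AffineData.id], by
    rw [toFun_id]; rfl⟩
  inv_mem' := by
    rintro π ⟨A, hA, h⟩
    refine ⟨A.inv, det_inv_ne_zero hA, ?_⟩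
    have : π = A.toPerm hA := Equiv.ext fun g => congrFun h g
    rw [this]
    rfl

theorem hol_eq_affineSubgroup [Fact p.Prime] (hp : p ≠ 2) : Hol p = affineSubgroup p := by
  apply le_antisymm
  · refine sup_le ?_ ?_
    · rintro _ ⟨g, rfl⟩
      exact ⟨_, by simp [AffineData.det], leftMulHom_eq_toFun hp g⟩
    · rintro _ ⟨φ, rfl⟩
      obtain ⟨A, -, -, -, hA, h⟩ := exists_eq_toFun hp φ
      exact ⟨A, hA, h⟩
  · rintro π ⟨A, hA, h⟩
    let t : Heisenberg p := ⟨A.v₁, A.v₂, A.w + half p * A.v₁ * A.v₂⟩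
    let B : AffineData p := ⟨A.a, A.b, A.c, A.d, 0, 0, 0,
      A.m₁ - half p * (A.v₂ * A.a - A.v₁ * A.c), A.m₂ - half p * (A.v₂ * A.b - A.v₁ * A.d)⟩
    have : π = leftMulHom p t * MulAut.toPerm _ (B.toMulAut hp hA rfl rfl rfl) := by
      apply DFunLike.coe_injective
      rw [mul_eq_comp (leftMulHom_eq_toFun hp t)
        (A' := B) rfl, h]
      congr 1
      ext <;> simp [comp, t, B] <;> ring
    rw [this]
    exact mul_mem (Subgroup.mem_sup_left ⟨_, rfl⟩) (Subgroup.mem_sup_right ⟨_, rfl⟩)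

theorem theta_eq_toFun [Fact p.Prime] (hp : p ≠ 2) {π : Equiv.Perm (Heisenberg p)}
    {A : AffineData p} (h : ⇑π = A.toFun) :
    ⇑(theta p π) = (⟨A.a, A.b, A.c, A.d, 0, 0, 0,
      A.m₁ - half p * (A.v₂ * A.a - A.v₁ * A.c),
      A.m₂ - half p * (A.v₂ * A.b - A.v₁ * A.d)⟩ : AffineData p).toFun := by
  have h2 := two_mul_half hp
  funext g
  change (π 1)⁻¹ * π g = _
  rw [h]
  ext <;> simp [toFun]
  generalize half p = t at *
  grind

end Heisenberg

/-! ## Regular subgroups and conjugation -/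

section Regular

variable {X : Type*}

theorem isRegularSub_of_existsUnique {H : Subgroup (Equiv.Perm X)} (x₀ : X)
    (h : ∀ y, ∃! g : Equiv.Perm X, g ∈ H ∧ g x₀ = y) : IsRegularSub H := by
  intro x y
  obtain ⟨a, ⟨ha, rfl⟩, -⟩ := h x
  obtain ⟨b, ⟨hb, rfl⟩, hb'⟩ := h y
  refine ⟨b * a⁻¹, ⟨mul_mem hb (inv_mem ha), by simp⟩, ?_⟩
  rintro c ⟨hc, hc'⟩
  rw [← hb' (c * a) ⟨mul_mem hc ha, hc'⟩, mul_inv_cancel_right]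

theorem IsRegularSub.eq_of_le {H K : Subgroup (Equiv.Perm X)} (hH : IsRegularSub H)
    (hK : IsRegularSub K) (h : H ≤ K) (x₀ : X) : H = K := by
  refine le_antisymm h fun k hk => ?_
  obtain ⟨a, ⟨ha, ha'⟩, -⟩ := hH x₀ (k x₀)
  rwa [(hK x₀ (k x₀)).unique ⟨hk, rfl⟩ ⟨h ha, ha'⟩]

theorem IsRegularSub.eq_of_apply_eq {H : Subgroup (Equiv.Perm X)} (hH : IsRegularSub H)
    {a b : Equiv.Perm X} (ha : a ∈ H) (hb : b ∈ H) {x : X} (h : a x = b x) : a = b :=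
  (hH x (b x)).unique ⟨ha, h⟩ ⟨hb, rfl⟩

theorem IsRegularSub.card_eq {H : Subgroup (Equiv.Perm X)} (hH : IsRegularSub H) (x₀ : X) :
    Nat.card H = Nat.card X := by
  refine Nat.card_eq_of_bijective (fun g : H => g.1 x₀) ⟨fun a b h => ?_, fun y => ?_⟩
  · exact Subtype.ext (hH.eq_of_apply_eq a.2 b.2 h)
  · obtain ⟨a, ⟨ha, ha'⟩, -⟩ := hH x₀ y
    exact ⟨⟨a, ha⟩, ha'⟩

end Regular

namespace Heisenberg

variable {p : ℕ}

theorem mem_autConj {α : MulAut (Heisenberg p)} {G : Subgroup (Equiv.Perm (Heisenberg p))}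
    {π : Equiv.Perm (Heisenberg p)} :
    π ∈ autConj p α G ↔ ∃ g ∈ G, MulAut.toPerm _ α * g = π * MulAut.toPerm _ α := by
  simp [autConj, Subgroup.mem_map, mul_inv_eq_iff_eq_mul]

theorem autConj_one (G : Subgroup (Equiv.Perm (Heisenberg p))) : autConj p 1 G = G := by
  ext π
  simp [mem_autConj]

theorem autConj_autConj (α β : MulAut (Heisenberg p))
    (G : Subgroup (Equiv.Perm (Heisenberg p))) :
    autConj p α (autConj p β G) = autConj p (α * β) G := by
  rw [autConj, autConj, autConj, Subgroup.map_map, map_mul, map_mul]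
  rfl

theorem autConj_eq_iff {α : MulAut (Heisenberg p)}
    {G G' : Subgroup (Equiv.Perm (Heisenberg p))} :
    autConj p α G = G' ↔ G = autConj p α⁻¹ G' := by
  constructor
  · rintro rfl
    rw [autConj_autConj, inv_mul_cancel, autConj_one]
  · rintro rfl
    rw [autConj_autConj, mul_inv_cancel, autConj_one]

theorem nonempty_mulEquiv_autConj (α : MulAut (Heisenberg p))
    (G : Subgroup (Equiv.Perm (Heisenberg p))) : Nonempty (G ≃* autConj p α G) :=
  ⟨G.equivMapOfInjective _ (MulAut.conj _).injective⟩

theorem theta_conj (α : MulAut (Heisenberg p)) (π : Equiv.Perm (Heisenberg p)) :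
    theta p (MulAut.toPerm _ α * π * (MulAut.toPerm _ α)⁻¹) =
      MulAut.toPerm _ α * theta p π * (MulAut.toPerm _ α)⁻¹ := by
  ext1 g
  change (α (π (α⁻¹ 1)))⁻¹ * α (π (α⁻¹ g)) = α ((π 1)⁻¹ * π (α⁻¹ g))
  rw [map_one, map_mul, map_inv]

theorem cond16_autConj (α : MulAut (Heisenberg p)) {G : Subgroup (Equiv.Perm (Heisenberg p))}
    (h : cond16 p G) : cond16 p (autConj p α G) := by
  obtain ⟨h1, h2, h3⟩ := h
  refine ⟨?_, ?_, ?_⟩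
  · rintro _ ⟨g, hg, rfl⟩
    have hα : MulAut.toPerm _ α ∈ Hol p := Subgroup.mem_sup_right ⟨α, rfl⟩
    exact mul_mem (mul_mem hα (h1 hg)) (inv_mem hα)
  · intro x y
    obtain ⟨g, ⟨hg, hg'⟩, hu⟩ := h2 (α⁻¹ x) (α⁻¹ y)
    refine ⟨MulAut.conj (MulAut.toPerm _ α) g, ⟨⟨g, hg, rfl⟩, ?_⟩, ?_⟩
    · change α (g (α⁻¹ x)) = y
      rw [hg']
      exact α.apply_symm_apply y
    · rintro _ ⟨⟨k, hk, rfl⟩, hk'⟩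
      rw [hu k ⟨hk, ?_⟩]
      · rfl
      · rw [← hk']
        exact (α.symm_apply_apply _).symm
  · have : theta p '' (autConj p α G : Set (Equiv.Perm (Heisenberg p))) =
        MulAut.conj (MulAut.toPerm _ α) ''
          (theta p '' (G : Set (Equiv.Perm (Heisenberg p)))) := by
      simp only [autConj, Subgroup.coe_map, Set.image_image]
      exact Set.image_congr fun π _ => theta_conj α π
    rw [thetaCard, this, ← h3, thetaCard]
    exact Nat.card_image_of_injective (MulAut.conj _).injective _

theorem injOn_theta [Fact p.Prime] {G : Subgroup (Equiv.Perm (Heisenberg p))}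
    (h : cond16 p G) : Set.InjOn (theta p) (G : Set (Equiv.Perm (Heisenberg p))) := by
  rw [← Set.ncard_image_iff (Set.toFinite _), ← Nat.card_coe_set_eq, ← Nat.card_coe_set_eq]
  exact h.2.2.trans (card_eq.symm.trans (h.2.1.card_eq 1).symm)

/-! ## The standard family -/

open AffineData

/-- The affine data of the elements of the standard subgroups. -/
def stdData (s k e₁ e₂ : ZMod p) (g : Heisenberg p) : AffineData p where
  a := 1
  b := 0
  c := g.y * s
  d := 1
  v₁ := g.x
  v₂ := s * g.z + 2 * k * s * g.x
  w := g.y + half p * k * s * g.x ^ 2 + e₂ * g.x - e₁ * (s * g.z + 2 * k * s * g.x)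
  m₁ := k * s * g.x - e₁ * g.y * s
  m₂ := 0

theorem stdData_mul [Fact p.Prime] (hp : p ≠ 2) (s k e₁ e₂ : ZMod p) (g h : Heisenberg p) :
    stdData s k e₁ e₂ (g * h) = (stdData s k e₁ e₂ g).comp (stdData s k e₁ e₂ h) := by
  have := two_mul_half hp
  ext <;> simp [stdData, comp]
  · ring
  · ring
  · ring
  · linear_combination k * s * g.x * h.x * this
  · ring

/-- The regular representation of the Heisenberg group on itself with data `stdData`. -/
def stdHom [Fact p.Prime] (hp : p ≠ 2) (s k e₁ e₂ : ZMod p) :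
    Heisenberg p →* Equiv.Perm (Heisenberg p) :=
  MonoidHom.toHomPerm
    { toFun := fun g => (stdData s k e₁ e₂ g).toFun
      map_one' := by
        rw [show stdData s k e₁ e₂ 1 = AffineData.id p by
          ext <;> simp [stdData, AffineData.id], toFun_id]
        rfl
      map_mul' := fun g h => by
        rw [stdData_mul hp, toFun_comp]
        rfl }

theorem coe_stdHom [Fact p.Prime] (hp : p ≠ 2) (s k e₁ e₂ : ZMod p) (g : Heisenberg p) :
    ⇑(stdHom hp s k e₁ e₂ g) = (stdData s k e₁ e₂ g).toFun := rfl

theorem stdData_injective [Fact p.Prime] {s : ZMod p} (hs : s ≠ 0) (k e₁ e₂ : ZMod p) :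
    Function.Injective (stdData s k e₁ e₂) := by
  intro g h H
  have hx := congrArg AffineData.v₁ H
  have hy := congrArg AffineData.c H
  have hz := congrArg AffineData.v₂ H
  simp only [stdData] at hx hy hz
  rw [hx, add_left_inj] at hz
  exact Heisenberg.ext hx (mul_right_cancel₀ hs hy) (mul_left_cancel₀ hs hz)

theorem stdHom_injective [Fact p.Prime] (hp : p ≠ 2) {s : ZMod p} (hs : s ≠ 0)
    (k e₁ e₂ : ZMod p) : Function.Injective (stdHom hp s k e₁ e₂) := fun g h H =>
  stdData_injective hs k e₁ e₂ (toFun_injective (by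
    rw [← coe_stdHom hp, ← coe_stdHom hp, H]))

/-- The standard regular subgroups. -/
def std [Fact p.Prime] (hp : p ≠ 2) (s k e₁ e₂ : ZMod p) :
    Subgroup (Equiv.Perm (Heisenberg p)) := (stdHom hp s k e₁ e₂).range

theorem nonempty_std_mulEquiv [Fact p.Prime] (hp : p ≠ 2) {s : ZMod p} (hs : s ≠ 0)
    (k e₁ e₂ : ZMod p) : Nonempty (std hp s k e₁ e₂ ≃* Heisenberg p) :=
  ⟨(MonoidHom.ofInjective (stdHom_injective hp hs k e₁ e₂)).symm⟩

theorem stdHom_apply_one [Fact p.Prime] (hp : p ≠ 2) (s k e₁ e₂ : ZMod p) (g : Heisenberg p) :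
    stdHom hp s k e₁ e₂ g 1 = ⟨(stdData s k e₁ e₂ g).v₁, (stdData s k e₁ e₂ g).v₂,
      half p * (stdData s k e₁ e₂ g).v₁ * (stdData s k e₁ e₂ g).v₂ + (stdData s k e₁ e₂ g).w⟩ := by
  rw [coe_stdHom]
  ext <;> simp [toFun]

theorem isRegularSub_std [Fact p.Prime] (hp : p ≠ 2) {s : ZMod p} (hs : s ≠ 0)
    (k e₁ e₂ : ZMod p) : IsRegularSub (std hp s k e₁ e₂) := by
  have hinj : Function.Injective fun g => stdHom hp s k e₁ e₂ g 1 := by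
    intro g h H
    simp only [stdHom_apply_one, Heisenberg.mk.injEq] at H
    obtain ⟨h1, h2, h3⟩ := H
    rw [h1, h2, add_right_inj] at h3
    simp only [stdData] at h1 h2 h3
    rw [h1, add_left_inj] at h2
    have hz := mul_left_cancel₀ hs h2
    rw [h1, hz] at h3
    exact Heisenberg.ext h1 (by linear_combination h3) hz
  refine isRegularSub_of_existsUnique 1 fun y => ?_
  obtain ⟨g, hg⟩ := (Finite.injective_iff_surjective.1 hinj) y
  refine ⟨_, ⟨⟨g, rfl⟩, hg⟩, ?_⟩
  rintro _ ⟨⟨h, rfl⟩, hh⟩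
  rw [hinj (hh.trans hg.symm)]

theorem cond16_std [Fact p.Prime] (hp : p ≠ 2) {s : ZMod p} (hs : s ≠ 0)
    (k e₁ e₂ : ZMod p) : cond16 p (std hp s k e₁ e₂) := by
  have hh := two_mul_half hp
  have hreg := isRegularSub_std hp hs k e₁ e₂
  refine ⟨?_, hreg, ?_⟩
  · rw [hol_eq_affineSubgroup hp]
    rintro _ ⟨g, rfl⟩
    exact ⟨_, by simp [AffineData.det, stdData], coe_stdHom hp _ _ _ _ _⟩
  · rw [thetaCard, ← card_eq, ← hreg.card_eq 1, Nat.card_coe_set_eq,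
      (Set.ncard_image_iff (Set.toFinite _)).2, ← Nat.card_coe_set_eq]
    · rfl
    rintro _ ⟨g, rfl⟩ _ ⟨h, rfl⟩ H
    have := (theta_eq_toFun hp (coe_stdHom hp s k e₁ e₂ g)).symm.trans
      ((congrArg _ H).trans (theta_eq_toFun hp (coe_stdHom hp s k e₁ e₂ h)))
    have := toFun_injective this
    simp only [AffineData.mk.injEq, stdData] at this
    obtain ⟨-, -, hc, -, -, -, -, h1, h2⟩ := this
    have hy := mul_right_cancel₀ hs hc
    have hx : g.x = h.x := by linear_combination 2 * h2 - (g.x - h.x) * hh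
    rw [hx, hy] at h1
    have hz : s * g.z = s * h.z := by
      linear_combination -2 * h1 - (s * g.z - s * h.z) * hh
    rw [Heisenberg.ext hx hy (mul_left_cancel₀ hs hz)]

theorem std_le [Fact p.Prime] (hp : p ≠ 2) {s : ZMod p} (hs : s ≠ 0) (k e₁ e₂ f : ZMod p)
    {H : Subgroup (Equiv.Perm (Heisenberg p))}
    (h₁ : stdHom hp s k e₁ e₂ ⟨0, 0, -2 * s⁻¹⟩ ∈ H)
    (h₂ : stdHom hp s k e₁ e₂ ⟨0, s⁻¹, f⟩ ∈ H)
    (h₃ : stdHom hp s k e₁ e₂ ⟨2, 0, 0⟩ ∈ H) : std hp s k e₁ e₂ ≤ H := by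
  have h2 := two_ne_zero_of_ne_two hp
  rw [std, MonoidHom.range_eq_map, Subgroup.map_le_iff_le_comap]
  generalize hK : H.comap (stdHom hp s k e₁ e₂) = K
  replace h₁ : (⟨0, 0, -2 * s⁻¹⟩ : Heisenberg p) ∈ K := hK ▸ h₁
  replace h₂ : (⟨0, s⁻¹, f⟩ : Heisenberg p) ∈ K := hK ▸ h₂
  replace h₃ : (⟨2, 0, 0⟩ : Heisenberg p) ∈ K := hK ▸ h₃
  have hz (z : ZMod p) : (⟨0, 0, z⟩ : Heisenberg p) ∈ K := by
    have := K.pow_mem h₁ (-2⁻¹ * s * z).val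
    rw [pow_eq_of_mul_eq_zero _ (by simp), ZMod.natCast_zmod_val] at this
    convert this using 2 <;> simp
    field_simp
  have hx (x : ZMod p) : (⟨x, 0, 0⟩ : Heisenberg p) ∈ K := by
    have := K.pow_mem h₃ (2⁻¹ * x).val
    rw [pow_eq_of_mul_eq_zero _ (by simp), ZMod.natCast_zmod_val] at this
    convert this using 2 <;> simp
    field_simp
  have hy (y : ZMod p) : (⟨0, y, s * y * f⟩ : Heisenberg p) ∈ K := by
    have := K.pow_mem h₂ (s * y).val
    rw [pow_eq_of_mul_eq_zero _ (by simp), ZMod.natCast_zmod_val] at this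
    convert this using 2 <;> simp
    field_simp
  intro g _
  have := K.mul_mem (K.mul_mem (hx g.x) (hy g.y)) (hz (g.z - s * g.y * f))
  convert this using 1
  ext <;> simp

end Heisenberg

/-! ## Classification -/

namespace Heisenberg

open AffineData

variable {p : ℕ}

theorem exists_data [Fact p.Prime] (hp : p ≠ 2) {G : Subgroup (Equiv.Perm (Heisenberg p))}
    (hG : cond16 p G) {π : Equiv.Perm (Heisenberg p)} (hπ : π ∈ G) :
    ∃ A : AffineData p, ⇑π = A.toFun := by
  have := hG.1 hπ
  rw [hol_eq_affineSubgroup hp] at this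
  obtain ⟨A, -, hA⟩ := this
  exact ⟨A, hA⟩

theorem exists_pow_data {π : Equiv.Perm (Heisenberg p)} {A : AffineData p}
    (h : ⇑π = A.toFun) (n : ℕ) :
    ∃ A' : AffineData p, ⇑(π ^ n) = A'.toFun ∧ A'.matrix = A.matrix ^ n := by
  induction n with
  | zero => exact ⟨AffineData.id p, by rw [toFun_id]; rfl, by
      simp [AffineData.matrix, AffineData.id, Matrix.one_fin_two]⟩
  | succ n ih =>
    obtain ⟨A', h1, h2⟩ := ih
    exact ⟨A'.comp A, by rw [pow_succ, mul_eq_comp h1 h], by rw [matrix_comp, h2, pow_succ]⟩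

theorem unipotent [Fact p.Prime] {G : Subgroup (Equiv.Perm (Heisenberg p))}
    (hG : cond16 p G) {π : Equiv.Perm (Heisenberg p)} (hπ : π ∈ G) {A : AffineData p}
    (hA : ⇑π = A.toFun) : A.a + A.d = 2 ∧ A.a * A.d - A.b * A.c = 1 := by
  have hpow : π ^ p ^ 3 = 1 := by
    have := pow_card_eq_one' (x := (⟨π, hπ⟩ : G))
    rw [hG.2.1.card_eq 1, card_eq] at this
    exact congrArg Subtype.val this
  obtain ⟨A', h1, h2⟩ := exists_pow_data hA (p ^ 3)
  have hid : A' = AffineData.id p := toFun_injective (by rw [← h1, hpow, toFun_id]; rfl)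
  have hone : A.matrix ^ p ^ 3 = 1 := by
    rw [← h2, hid]
    simp [AffineData.matrix, AffineData.id, Matrix.one_fin_two]
  have hnil : IsNilpotent (A.matrix - 1) :=
    ⟨p ^ 3, by rw [sub_pow_char_pow_of_commute p 3 (Commute.one_right _), hone]; simp⟩
  have htr := (Matrix.isNilpotent_trace_of_isNilpotent hnil).eq_zero
  have hdet : (A.matrix - 1).det = 0 := by
    obtain ⟨n, hn⟩ := hnil
    have := congrArg Matrix.det hn
    rw [Matrix.det_pow, Matrix.det_zero] at this
    exact eq_zero_of_pow_eq_zero this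
  simp only [AffineData.matrix, Matrix.one_fin_two, Matrix.trace_fin_two, Matrix.det_fin_two,
    Matrix.sub_apply, Matrix.of_apply, Matrix.cons_val_zero, Matrix.cons_val_one,
    Matrix.cons_val', Matrix.cons_val_fin_one] at htr hdet
  exact ⟨by linear_combination htr, by linear_combination hdet + htr⟩

/-- All elements have a lower unitriangular linear part. -/
def IsLower (G : Subgroup (Equiv.Perm (Heisenberg p))) : Prop :=
  ∀ π ∈ G, ∃ A : AffineData p, ⇑π = A.toFun ∧ A.a = 1 ∧ A.b = 0 ∧ A.d = 1

/-- Affine data whose linear part maps the line `x = 0` to a given line. -/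
def flagData : Option (ZMod p) → AffineData p
  | none => AffineData.id p
  | some y => ⟨0, 1, -1, y, 0, 0, 0, 0, 0⟩

/-- An automorphism that maps the line `x = 0` to a given line. -/
def flagAut [Fact p.Prime] (hp : p ≠ 2) (n : Option (ZMod p)) : MulAut (Heisenberg p) :=
  (flagData n).toMulAut hp (by cases n <;> simp [flagData, AffineData.det, AffineData.id])
    (by cases n <;> rfl) (by cases n <;> rfl) (by cases n <;> rfl)

theorem exists_isLower [Fact p.Prime] (hp : p ≠ 2)
    {G : Subgroup (Equiv.Perm (Heisenberg p))} (hG : cond16 p G) :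
    ∃ n, IsLower (autConj p (flagAut hp n)⁻¹ G) := by
  suffices ∃ n, ∀ π ∈ autConj p (flagAut hp n)⁻¹ G, ∀ A : AffineData p, ⇑π = A.toFun →
      A.b = 0 by
    obtain ⟨n, hn⟩ := this
    refine ⟨n, fun π hπ => ?_⟩
    have hG' := cond16_autConj (flagAut hp n)⁻¹ hG
    obtain ⟨A, hA⟩ := exists_data hp hG' hπ
    have hb := hn π hπ A hA
    obtain ⟨h1, h2⟩ := unipotent hG' hπ hA
    rw [hb, zero_mul, sub_zero] at h2
    have ha : A.a = 1 := by
      have : (A.a - 1) ^ 2 = 0 := by linear_combination A.a * h1 - h2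
      linear_combination pow_eq_zero_iff two_ne_zero |>.1 this
    exact ⟨A, hA, ha, hb, by linear_combination h1 - ha⟩
  by_cases hall : ∀ π ∈ G, ∀ A : AffineData p, ⇑π = A.toFun → A.b = 0
  · refine ⟨none, ?_⟩
    have : flagAut hp none = 1 := by
      ext1 g
      change (AffineData.id p).toFun g = g
      rw [toFun_id]
      rfl
    rw [this, inv_one, autConj_one]
    exact hall
  push Not at hall
  obtain ⟨π, hπ, A, hA, hb⟩ := hall
  refine ⟨some (-(A.a - 1) / A.b), fun π' hπ' A' hA' => ?_⟩
  obtain ⟨g, hg, hgπ⟩ : ∃ g ∈ G, g * MulAut.toPerm _ (flagAut hp (some (-(A.a - 1) / A.b))) =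
      MulAut.toPerm _ (flagAut hp (some (-(A.a - 1) / A.b))) * π' := by
    obtain ⟨g, hg, h⟩ := mem_autConj.1 hπ'
    refine ⟨g, hg, ?_⟩
    rw [map_inv, inv_mul_eq_iff_eq_mul, ← mul_assoc, eq_mul_inv_iff_mul_eq] at h
    exact h
  obtain ⟨B, hB⟩ := exists_data hp hG hg
  have hF : ⇑(MulAut.toPerm _ (flagAut hp (some (-(A.a - 1) / A.b)))) =
    (flagData (some (-(A.a - 1) / A.b))).toFun := rfl
  have key : B.comp (flagData (some (-(A.a - 1) / A.b))) =
      (flagData (some (-(A.a - 1) / A.b))).comp A' := toFun_injective (by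
    rw [← mul_eq_comp hB hF, ← mul_eq_comp hF hA', hgπ])
  have k1 := congrArg AffineData.b key
  have k2 := congrArg AffineData.d key
  obtain ⟨t1, d1⟩ := unipotent hG hπ hA
  obtain ⟨t2, d2⟩ := unipotent hG hg hB
  have t3 := (unipotent hG (mul_mem hπ hg) (mul_eq_comp hA hB)).1
  generalize hy : -(A.a - 1) / A.b = y at *
  rw [div_eq_iff hb] at hy
  simp only [comp, flagData] at k1 k2 t3
  have hd : A.d = 2 - A.a := by linear_combination t1
  have hd' : B.d = 2 - B.a := by linear_combination t2
  rw [hd] at d1 t3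
  rw [hd'] at t3 k2
  have e : A'.b = 2 * (B.a - 1) * y + B.b * y ^ 2 - B.c := by linear_combination k2 - y * k1
  have goal : A.b ^ 2 * A'.b = 0 := by
    rw [e]
    linear_combination -A.b * t3 - B.b * d1 -
      (2 * (B.a - 1) * A.b + B.b * (y * A.b - (A.a - 1))) * hy
  exact (mul_eq_zero.1 goal).resolve_left (pow_ne_zero 2 hb)

/-- Affine data with lower unitriangular linear part, with `λ₁` and `λ₂` the coefficients of the
central part of the automorphism component. -/
def lowerData (c l₁ l₂ v₁ v₂ w : ZMod p) : AffineData p :=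
  ⟨1, 0, c, 1, v₁, v₂, w, l₁ + half p * (v₂ - v₁ * c), l₂ - half p * v₁⟩

theorem lowerData_comp (c l₁ l₂ v₁ v₂ w c' l₁' l₂' v₁' v₂' w' : ZMod p) :
    (lowerData c l₁ l₂ v₁ v₂ w).comp (lowerData c' l₁' l₂' v₁' v₂' w') =
      lowerData (c + c') (l₁ + l₂ * c' + l₁') (l₂ + l₂') (v₁ + v₁') (v₂ + v₂' + c * v₁')
        (w + w' + (l₁ + half p * (v₂ - v₁ * c)) * v₁' + (l₂ - half p * v₁) * v₂') := by
  ext <;> simp only [comp, lowerData] <;> ring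

/-- The subgroup contains the permutation with the given lower unitriangular data. -/
def HasLower (G : Subgroup (Equiv.Perm (Heisenberg p))) (c l₁ l₂ v₁ v₂ w : ZMod p) : Prop :=
  ∃ π ∈ G, ⇑π = (lowerData c l₁ l₂ v₁ v₂ w).toFun

section HasLower

variable {G : Subgroup (Equiv.Perm (Heisenberg p))}
  {c l₁ l₂ v₁ v₂ w c' l₁' l₂' v₁' v₂' w' : ZMod p}

theorem HasLower.mul (h : HasLower G c l₁ l₂ v₁ v₂ w) (h' : HasLower G c' l₁' l₂' v₁' v₂' w') :
    HasLower G (c + c') (l₁ + l₂ * c' + l₁') (l₂ + l₂') (v₁ + v₁') (v₂ + v₂' + c * v₁')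
      (w + w' + (l₁ + half p * (v₂ - v₁ * c)) * v₁' + (l₂ - half p * v₁) * v₂') := by
  obtain ⟨π, hπ, e⟩ := h
  obtain ⟨π', hπ', e'⟩ := h'
  exact ⟨π * π', mul_mem hπ hπ', by rw [mul_eq_comp e e', lowerData_comp]⟩

theorem HasLower.eq_id_of_fixed (hG : cond16 p G) (h : HasLower G c l₁ l₂ v₁ v₂ w)
    {g : Heisenberg p} (hg : (lowerData c l₁ l₂ v₁ v₂ w).toFun g = g) :
    lowerData c l₁ l₂ v₁ v₂ w = AffineData.id p := by
  obtain ⟨π, hπ, e⟩ := h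
  have : π = 1 := hG.2.1.eq_of_apply_eq hπ (one_mem G) (x := g) (by rw [e, hg]; rfl)
  exact toFun_injective (by rw [← e, this, toFun_id]; rfl)

variable [Fact p.Prime]

theorem theta_eq_of_lowerData (hp : p ≠ 2) {π : Equiv.Perm (Heisenberg p)}
    (h : ⇑π = (lowerData c l₁ l₂ v₁ v₂ w).toFun) :
    ⇑(theta p π) = (⟨1, 0, c, 1, 0, 0, 0, l₁, l₂⟩ : AffineData p).toFun := by
  rw [theta_eq_toFun hp h]
  congr 1
  ext <;> simp [lowerData]

theorem HasLower.unique (hp : p ≠ 2) (hG : cond16 p G) (h : HasLower G c l₁ l₂ v₁ v₂ w)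
    (h' : HasLower G c' l₁' l₂' v₁' v₂' w') (hc : c = c') (h₁ : l₁ = l₁') (h₂ : l₂ = l₂') :
    v₁ = v₁' ∧ v₂ = v₂' ∧ w = w' := by
  subst hc h₁ h₂
  obtain ⟨π, hπ, e⟩ := h
  obtain ⟨π', hπ', e'⟩ := h'
  have : π = π' := injOn_theta hG hπ hπ' (DFunLike.coe_injective
    ((theta_eq_of_lowerData hp e).trans (theta_eq_of_lowerData hp e').symm))
  have := toFun_injective (e.symm.trans ((congrArg _ this).trans e'))
  exact ⟨congrArg AffineData.v₁ this, congrArg AffineData.v₂ this, congrArg AffineData.w this⟩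

theorem exists_hasLower (hp : p ≠ 2) (hG : cond16 p G) (hL : IsLower G) (c l₁ l₂ : ZMod p) :
    ∃ v₁ v₂ w, HasLower G c l₁ l₂ v₁ v₂ w := by
  have hex (π : G) : ∃ t : ZMod p × ZMod p × ZMod p, ∃ v₁ v₂ w,
      ⇑π.1 = (lowerData t.1 t.2.1 t.2.2 v₁ v₂ w).toFun := by
    obtain ⟨A, hA, ha, hb, hd⟩ := hL π π.2
    refine ⟨(A.c, A.m₁ - half p * (A.v₂ - A.v₁ * A.c), A.m₂ + half p * A.v₁),
      A.v₁, A.v₂, A.w, ?_⟩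
    rw [hA]
    congr 1
    ext <;> simp [lowerData, *]
  choose f hf using hex
  have hinj : Function.Injective f := by
    intro π π' h
    obtain ⟨v₁, v₂, w, e⟩ := hf π
    obtain ⟨v₁', v₂', w', e'⟩ := hf π'
    rw [← h] at e'
    exact Subtype.ext (injOn_theta hG π.2 π'.2 (DFunLike.coe_injective
      ((theta_eq_of_lowerData hp e).trans (theta_eq_of_lowerData hp e').symm)))
  have hbij := hinj.bijective_of_nat_card_le (by
    rw [hG.2.1.card_eq 1, Nat.card_congr (equivProd p)])
  obtain ⟨π, hπ⟩ := hbij.2 (c, l₁, l₂)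
  obtain ⟨v₁, v₂, w, e⟩ := hf π
  rw [hπ] at e
  exact ⟨v₁, v₂, w, π, π.2, e⟩

end HasLower

theorem exists_eq_std_of_isLower [Fact p.Prime] (hp : p ≠ 2)
    {G : Subgroup (Equiv.Perm (Heisenberg p))} (hG : cond16 p G) (hL : IsLower G) :
    ∃ s k e₁ e₂, ∃ _ : s ≠ 0, G = std hp s k e₁ e₂ := by
  have hh := two_mul_half hp
  obtain ⟨a, b, w₁, E₁⟩ := exists_hasLower hp hG hL 0 1 0
  obtain ⟨r, q, w₃, E₃⟩ := exists_hasLower hp hG hL 0 0 1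
  obtain ⟨f, g, w₂, E₂⟩ := exists_hasLower hp hG hL 1 0 0
  obtain ⟨-, r1, r2⟩ := (E₂.mul E₁).unique hp hG (E₁.mul E₂) (by ring) (by ring) (by ring)
  have ha : a = 0 := by linear_combination r1
  subst ha
  obtain ⟨-, -, r3⟩ := (E₁.mul E₃).unique hp hG (E₃.mul E₁) (by ring) (by ring) (by ring)
  obtain ⟨-, r4, r5⟩ := (E₃.mul E₂).unique hp hG (E₂.mul (E₃.mul E₁)) (by ring) (by ring)
    (by ring)
  have hb : b = -r := by linear_combination -r4
  subst hb
  have hr0 : r ≠ 0 := by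
    rintro rfl
    have := E₁.eq_id_of_fixed hG (g := ⟨-w₁, 0, 0⟩) (by
      ext <;> simp [toFun, lowerData])
    simpa [lowerData, AffineData.id] using congrArg AffineData.m₁ this
  have hr : r = 2 := by
    have : r * (2 - r) = 0 := by linear_combination r3 + r ^ 2 * hh
    linear_combination -(mul_eq_zero.1 this).resolve_left hr0
  subst hr
  have hf : f = 0 := by linear_combination r2 - 2 * f * hh
  subst hf
  have hw₁ : w₁ = -g := by linear_combination -r5 - (2 * g + 2) * hh
  subst hw₁
  have hpow (n : ℕ) : HasLower G 0 n 0 0 (-2 * n) (-g * n) := by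
    induction n with
    | zero => exact ⟨1, one_mem G, by
        have : lowerData (0 : ZMod p) (0 : ℕ) 0 0 (-2 * (0 : ℕ)) (-g * (0 : ℕ)) =
            AffineData.id p := by
          ext <;> simp [lowerData, AffineData.id]
        rw [this, toFun_id]
        rfl⟩
    | succ n ih =>
      convert ih.mul E₁ using 1
      all_goals push_cast; ring
  have hdisc : w₂ - half p * g ^ 2 ≠ 0 := by
    intro h
    have hn := hpow (half p * g).val
    rw [ZMod.natCast_zmod_val] at hn
    have := (E₂.mul hn).eq_id_of_fixed hG (g := 1) (by
      ext <;> simp [toFun, lowerData]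
      · linear_combination -g * hh
      · linear_combination h)
    simpa [lowerData, AffineData.id] using congrArg AffineData.c this
  obtain ⟨π₁, hπ₁, E₁⟩ := E₁
  obtain ⟨π₂, hπ₂, E₂⟩ := E₂
  obtain ⟨π₃, hπ₃, E₃⟩ := E₃
  obtain ⟨s, hs, hsw⟩ : ∃ s, s ≠ 0 ∧ s⁻¹ = w₂ - half p * g ^ 2 :=
    ⟨_, inv_ne_zero hdisc, inv_inv _⟩
  obtain ⟨k, hk⟩ : ∃ k, k * s = half p ^ 2 * q :=
    ⟨half p ^ 2 * q * s⁻¹, by field_simp⟩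
  refine ⟨s, k, -half p * g, half p * (w₃ - 2 * (k * s) - half p * g * q), hs, ?_⟩
  refine (IsRegularSub.eq_of_le (isRegularSub_std hp hs _ _ _) hG.2.1 ?_ 1).symm
  refine std_le hp hs _ _ _ (g * s⁻¹) ?_ ?_ ?_
  · convert hπ₁
    apply DFunLike.coe_injective
    rw [coe_stdHom, E₁]
    congr 1
    ext <;> simp [stdData, lowerData]
    · field_simp
    · field_simp
      linear_combination g * hh
    · linear_combination hh
  · convert hπ₂
    apply DFunLike.coe_injective
    rw [coe_stdHom, E₂]
    congr 1
    ext <;> simp [stdData, lowerData]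
    · field_simp
    · field_simp
    · linear_combination hsw + half p * g ^ 2 * mul_inv_cancel₀ hs
    · field_simp
  · convert hπ₃
    apply DFunLike.coe_injective
    rw [coe_stdHom, E₃]
    congr 1
    ext <;> simp [stdData, lowerData]
    · linear_combination 4 * hk + q * (2 * half p + 1) * hh
    · linear_combination 4 * half p * g * hk +
        (w₃ + half p * g * q * (2 * half p)) * hh
    · linear_combination 2 * hk + half p * q * hh
    · linear_combination hh

end Heisenberg

/-! ## Conjugacy of the standard subgroups -/

namespace Heisenberg

open AffineData

variable {p : ℕ} [Fact p.Prime]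

theorem exists_comp_stdData_eq (hp : p ≠ 2) {s k e₁ e₂ s' k' e₁' e₂' : ZMod p}
    {α : MulAut (Heisenberg p)} {A : AffineData p} (hA : ⇑α = A.toFun)
    (h : autConj p α (std hp s k e₁ e₂) = std hp s' k' e₁' e₂') (g : Heisenberg p) :
    ∃ g', A.comp (stdData s k e₁ e₂ g) = (stdData s' k' e₁' e₂' g').comp A := by
  have hA' : ⇑(MulAut.toPerm _ α) = A.toFun := hA
  have hmem : MulAut.toPerm _ α * stdHom hp s k e₁ e₂ g * (MulAut.toPerm _ α)⁻¹ ∈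
      autConj p α (std hp s k e₁ e₂) := mem_autConj.2 ⟨_, ⟨g, rfl⟩, by simp⟩
  rw [h] at hmem
  obtain ⟨g', hg'⟩ := hmem
  refine ⟨g', toFun_injective ?_⟩
  rw [← mul_eq_comp hA' (coe_stdHom hp s k e₁ e₂ g),
    ← mul_eq_comp (coe_stdHom hp s' k' e₁' e₂' g') hA', hg', inv_mul_cancel_right]

theorem invariants_of_autConj_std_eq (hp : p ≠ 2) {s k e₁ e₂ s' k' e₁' e₂' : ZMod p}
    (hs : s ≠ 0) (hs' : s' ≠ 0) {α : MulAut (Heisenberg p)} {A : AffineData p}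
    (hA : ⇑α = A.toFun) (h₁ : A.v₁ = 0) (h₂ : A.v₂ = 0) (h₃ : A.w = 0) (hdet : A.det ≠ 0)
    (h : autConj p α (std hp s k e₁ e₂) = std hp s' k' e₁' e₂') :
    A.b = 0 ∧ A.a ≠ 0 ∧ s = A.a ^ 2 * s' ∧ k' = A.det * k := by
  obtain ⟨g, hg⟩ := exists_comp_stdData_eq hp hA h ⟨0, 1, 0⟩
  obtain ⟨g', hg'⟩ := exists_comp_stdData_eq hp hA h ⟨1, 0, 0⟩
  simp only [comp, stdData, h₁, h₂, h₃, AffineData.mk.injEq] at hg hg'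
  simp only [det] at hdet ⊢
  obtain ⟨A1, A2, A3, A4, A5, A6, A7, A8, A9⟩ := hg
  obtain ⟨B1, B2, B3, B4, B5, B6, B7, B8, B9⟩ := hg'
  have hb : A.b = 0 := by
    have : A.b * s = 0 := by linear_combination A1
    exact (mul_eq_zero.1 this).resolve_right hs
  have ha : A.a ≠ 0 := by
    intro ha
    rw [ha, hb] at hdet
    simp at hdet
  have hd : A.d ≠ 0 := by
    intro hd
    rw [hd, hb] at hdet
    simp at hdet
  rw [hb] at A7 A8 B5 B8 ⊢
  have hx : g.x = 0 := by linear_combination -A5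
  have hz : g.z = 0 := by
    refine (mul_eq_zero.1 (?_ : s' * g.z = 0)).resolve_left hs'
    linear_combination -A6 - 2 * k' * s' * hx
  have hy : g.y = A.a * A.d := by
    linear_combination -A7 - (half p * k' * s' * g.x + e₂' - 2 * e₁' * k' * s') * hx + e₁' * s' * hz
  have hs_eq : s = A.a ^ 2 * s' := by
    refine mul_left_cancel₀ hd ?_
    linear_combination A3 + s' * A.a * hy
  have hy' : g'.y = 0 := by
    refine (mul_eq_zero.1 (?_ : g'.y * (s' * A.a) = 0)).resolve_right (mul_ne_zero hs' ha)
    linear_combination -B3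
  have hx' : g'.x = A.a := by linear_combination -B5
  refine ⟨rfl, ha, hs_eq, ?_⟩
  refine mul_right_cancel₀ hs ?_
  linear_combination -B8 + k' * hs_eq - k' * s' * A.a * hx' + e₁' * s' * A.a * hy'

theorem std_injective (hp : p ≠ 2) {s k e₁ e₂ s' k' e₁' e₂' : ZMod p}
    (hs : s ≠ 0) (hs' : s' ≠ 0) (h : std hp s k e₁ e₂ = std hp s' k' e₁' e₂') :
    s = s' ∧ k = k' ∧ e₁ = e₁' ∧ e₂ = e₂' := by
  have h' : autConj p 1 (std hp s k e₁ e₂) = std hp s' k' e₁' e₂' := by rw [autConj_one, h]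
  have h1 : ⇑(1 : MulAut (Heisenberg p)) = (AffineData.id p).toFun := by
    rw [toFun_id]
    rfl
  obtain ⟨-, -, h3, h4⟩ := invariants_of_autConj_std_eq hp hs hs' h1 rfl rfl rfl
    (by simp [det, AffineData.id]) h'
  obtain rfl : s = s' := by simpa [AffineData.id] using h3
  obtain rfl : k' = k := by simpa [AffineData.id, det] using h4
  obtain ⟨g, hg⟩ := exists_comp_stdData_eq hp h1 h' ⟨0, 0, 1⟩
  obtain ⟨g', hg'⟩ := exists_comp_stdData_eq hp h1 h' ⟨1, 0, 0⟩
  simp only [comp, stdData, AffineData.id, AffineData.mk.injEq] at hg hg'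
  obtain ⟨A1, A2, A3, A4, A5, A6, A7, A8, A9⟩ := hg
  obtain ⟨B1, B2, B3, B4, B5, B6, B7, B8, B9⟩ := hg'
  have hy : g.y = 0 := by
    refine (mul_eq_zero.1 (?_ : g.y * s = 0)).resolve_right hs
    linear_combination -A3
  have hy' : g'.y = 0 := by
    refine (mul_eq_zero.1 (?_ : g'.y * s = 0)).resolve_right hs
    linear_combination -B3
  have hx : g.x = 0 := by linear_combination -A5
  have hx' : g'.x = 1 := by linear_combination -B5
  have he₁ : e₁ = e₁' := by
    refine mul_right_cancel₀ hs ?_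
    rw [hx, hy] at A7
    rw [hx] at A6
    linear_combination -A7 - e₁' * A6
  rw [hx', hy'] at B7
  rw [hx'] at B6
  exact ⟨rfl, rfl, he₁, by linear_combination B7 + e₁' * B6 + 2 * k' * s * he₁⟩

theorem toFun_flagAut (hp : p ≠ 2) (n : Option (ZMod p)) :
    ⇑(flagAut hp n) = (flagData n).toFun := rfl

theorem flag_injective (hp : p ≠ 2) {n n' : Option (ZMod p)}
    {s k e₁ e₂ s' k' e₁' e₂' : ZMod p} (hs : s ≠ 0) (hs' : s' ≠ 0)
    (h : autConj p (flagAut hp n) (std hp s k e₁ e₂) =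
      autConj p (flagAut hp n') (std hp s' k' e₁' e₂')) : n = n' := by
  have h1 := autConj_eq_iff.1 h.symm
  rw [autConj_autConj] at h1
  obtain ⟨A, h₁, h₂, h₃, hdet, hA⟩ := exists_eq_toFun hp ((flagAut hp n')⁻¹ * flagAut hp n)
  obtain ⟨hb, ha, -, -⟩ := invariants_of_autConj_std_eq hp hs hs' hA h₁ h₂ h₃ hdet h1.symm
  have key : (flagData n').comp A = flagData n := toFun_injective (by
    rw [toFun_comp, ← hA, ← toFun_flagAut hp, ← toFun_flagAut hp, ← MulAut.coe_mul,
      mul_inv_cancel_left])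
  have kb := congrArg AffineData.b key
  have kd := congrArg AffineData.d key
  simp only [comp, hb] at kb kd
  cases n <;> cases n' <;> simp_all [flagData, AffineData.id]

theorem autConj_std_diag (hp : p ≠ 2) {s x y : ZMod p} (hs : s ≠ 0) (hx : x ≠ 0) (hy : y ≠ 0)
    (k e₁ e₂ m₁ m₂ : ZMod p) :
    ∃ α : MulAut (Heisenberg p), autConj p α (std hp s k e₁ e₂) =
      std hp (s / x ^ 2) (k * (x * y)) (x * e₁ - m₂ / y) (y * e₂ + m₁ / x) := by
  have hdet : (⟨x, 0, 0, y, 0, 0, 0, m₁, m₂⟩ : AffineData p).det ≠ 0 := by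
    simp [det, hx, hy]
  have hA : ⇑(MulAut.toPerm _ (toMulAut ⟨x, 0, 0, y, 0, 0, 0, m₁, m₂⟩ hp hdet rfl rfl rfl)) =
    (⟨x, 0, 0, y, 0, 0, 0, m₁, m₂⟩ : AffineData p).toFun := rfl
  refine ⟨toMulAut ⟨x, 0, 0, y, 0, 0, 0, m₁, m₂⟩ hp hdet rfl rfl rfl, ?_⟩
  refine (cond16_autConj _ (cond16_std hp hs k e₁ e₂)).2.1.eq_of_le
    (isRegularSub_std hp (div_ne_zero hs (pow_ne_zero 2 hx)) _ _ _) ?_ 1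
  intro π hπ
  obtain ⟨_, ⟨g, rfl⟩, hg⟩ := mem_autConj.1 hπ
  refine ⟨⟨x * g.x, x * y * g.y, y * x ^ 2 * g.z⟩, ?_⟩
  rw [← mul_left_inj, ← hg]
  apply DFunLike.coe_injective
  rw [mul_eq_comp hA (coe_stdHom hp s k e₁ e₂ g), mul_eq_comp (coe_stdHom hp _ _ _ _ _) hA]
  congr 1
  ext <;> simp [comp, stdData] <;> field_simp <;> try ring

end Heisenberg

/-! ## Representatives, orbits and counting -/

namespace Heisenberg

open AffineData

variable {p : ℕ} [Fact p.Prime]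

theorem α₁_eq_toFun :
    ⇑(MulAut.toPerm (Heisenberg p) α₁) = (⟨1, 0, 0, 1, 0, 0, 0, 1, 0⟩ : AffineData p).toFun := by
  funext g
  change (⟨g.x, g.y, g.z + g.x⟩ : Heisenberg p) = _
  ext <;> simp [toFun]

theorem α₂_eq_toFun (hp : p ≠ 2) : ⇑(MulAut.toPerm (Heisenberg p) (α₂ p hp)) =
    (⟨1, 0, 1, 1, 0, 0, 0, -half p, 0⟩ : AffineData p).toFun := by
  funext g
  change (⟨g.x, g.x + g.y, g.z + g.x * (g.x - 1) / 2⟩ : Heisenberg p) = _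
  ext <;> simp [toFun, div_eq_mul_inv, half]
  ring

theorem α₃_eq_toFun :
    ⇑(MulAut.toPerm (Heisenberg p) α₃) = (⟨1, 0, 0, 1, 0, 0, 0, 0, 1⟩ : AffineData p).toFun := by
  funext g
  change (⟨g.x, g.y, g.z + g.y⟩ : Heisenberg p) = _
  ext <;> simp [toFun]

theorem rep16_eq_std (hp : p ≠ 2) {s : ZMod p} (hs : s ≠ 0) (t : ℕ) :
    rep16 p hp s t = std hp s⁻¹ (t * s * half p ^ 2) 0 (-3 * t * half p ^ 2) := by
  have hh := two_mul_half hp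
  have si := mul_inv_cancel₀ hs
  have e₁ : leftMulHom p (τ ^ 2)⁻¹ * MulAut.toPerm (Heisenberg p) α₁ =
      stdHom hp s⁻¹ (t * s * half p ^ 2) 0 (-3 * t * half p ^ 2) ⟨0, 0, -2 * s⁻¹⁻¹⟩ := by
    apply DFunLike.coe_injective
    rw [mul_eq_comp (leftMulHom_eq_toFun hp _) α₁_eq_toFun, coe_stdHom]
    congr 1
    rw [pow_eq_of_mul_eq_zero τ (by simp [τ])]
    ext <;> simp [comp, stdData, τ]
    · linear_combination -2 * si
    · linear_combination -hh
  have e₂ : leftMulHom p (ρ ^ s.val * τ) * MulAut.toPerm (Heisenberg p) (α₂ p hp) =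
      stdHom hp s⁻¹ (t * s * half p ^ 2) 0 (-3 * t * half p ^ 2) ⟨0, s⁻¹⁻¹, s⟩ := by
    apply DFunLike.coe_injective
    rw [mul_eq_comp (leftMulHom_eq_toFun hp _) (α₂_eq_toFun hp), coe_stdHom]
    congr 1
    rw [pow_eq_of_mul_eq_zero ρ (by simp [ρ])]
    ext <;> simp [comp, stdData, τ, ρ]
    · linear_combination -si
    · linear_combination -si
  have e₃ : leftMulHom p (σ ^ 2 * τ ^ t) * MulAut.toPerm (Heisenberg p) α₃ =
      stdHom hp s⁻¹ (t * s * half p ^ 2) 0 (-3 * t * half p ^ 2) ⟨2, 0, 0⟩ := by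
    apply DFunLike.coe_injective
    rw [mul_eq_comp (leftMulHom_eq_toFun hp _) α₃_eq_toFun, coe_stdHom]
    congr 1
    rw [pow_eq_of_mul_eq_zero τ (by simp [τ]), pow_eq_of_mul_eq_zero σ (by simp [σ])]
    ext <;> simp [comp, stdData, τ, σ]
    · linear_combination -4 * t * half p ^ 2 * si - t * (2 * half p + 1) * hh
    · linear_combination -4 * t * half p ^ 3 * si + 2 * half p * t * (1 - half p) * hh
    · linear_combination -2 * t * half p ^ 2 * si - half p * t * hh
    · linear_combination -hh
  rw [rep16, e₁, e₂, e₃]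
  refine le_antisymm ?_ (std_le hp (inv_ne_zero hs) _ _ _ s ?_ ?_ ?_)
  · rw [Subgroup.closure_le]
    rintro _ (rfl | rfl | rfl) <;> exact ⟨_, rfl⟩
  all_goals exact Subgroup.subset_closure (by simp)

theorem exists_eq_autConj_std (hp : p ≠ 2) {G : Subgroup (Equiv.Perm (Heisenberg p))}
    (hG : cond16 p G) : ∃ n s k e₁ e₂, ∃ _ : s ≠ 0,
      G = autConj p (flagAut hp n) (std hp s k e₁ e₂) := by
  obtain ⟨n, hn⟩ := exists_isLower hp hG
  obtain ⟨s, k, e₁, e₂, hs, h⟩ := exists_eq_std_of_isLower hp (cond16_autConj _ hG) hn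
  refine ⟨n, s, k, e₁, e₂, hs, ?_⟩
  rw [← h, autConj_autConj, mul_inv_cancel, autConj_one]

theorem nonempty_mulEquiv_of_cond16 (hp : p ≠ 2) {G : Subgroup (Equiv.Perm (Heisenberg p))}
    (hG : cond16 p G) : Nonempty (G ≃* Heisenberg p) := by
  obtain ⟨n, s, k, e₁, e₂, hs, rfl⟩ := exists_eq_autConj_std hp hG
  obtain ⟨f⟩ := nonempty_mulEquiv_autConj (flagAut hp n) (std hp s k e₁ e₂)
  obtain ⟨g⟩ := nonempty_std_mulEquiv hp hs k e₁ e₂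
  exact ⟨f.symm.trans g⟩

theorem card_cond16 (hp : p ≠ 2) :
    Nat.card {G : Subgroup (Equiv.Perm (Heisenberg p)) // cond16 p G} = (p ^ 2 - 1) * p ^ 3 := by
  let f : (ZMod p)ˣ × Option (ZMod p) × ZMod p × ZMod p × ZMod p →
      {G : Subgroup (Equiv.Perm (Heisenberg p)) // cond16 p G} := fun u =>
    ⟨autConj p (flagAut hp u.2.1) (std hp u.1 u.2.2.1 u.2.2.2.1 u.2.2.2.2),
      cond16_autConj _ (cond16_std hp u.1.ne_zero _ _ _)⟩
  have hf : f.Bijective := by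
    constructor
    · rintro ⟨s, n, k, e₁, e₂⟩ ⟨s', n', k', e₁', e₂'⟩ h
      have h := congrArg Subtype.val h
      obtain rfl := flag_injective hp s.ne_zero s'.ne_zero h
      have h' := autConj_eq_iff.1 h
      rw [autConj_autConj, inv_mul_cancel, autConj_one] at h'
      obtain ⟨h1, rfl, rfl, rfl⟩ := std_injective hp s.ne_zero s'.ne_zero h'
      rw [Units.ext h1]
    · rintro ⟨G, hG⟩
      obtain ⟨n, s, k, e₁, e₂, hs, rfl⟩ := exists_eq_autConj_std hp hG
      exact ⟨⟨Units.mk0 s hs, n, k, e₁, e₂⟩, rfl⟩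
  rw [← Nat.card_eq_of_bijective f hf]
  simp only [Nat.card_prod, Nat.card_zmod, Finite.card_option]
  rw [Nat.card_eq_fintype_card, ZMod.card_units]
  have : p ^ 2 - 1 = (p + 1) * (p - 1) := by rw [← Nat.sq_sub_sq, one_pow]
  rw [this]
  ring

theorem exists_isSquare_mul {δ : ZMod p} (hp : p ≠ 2) (hδ : ¬IsSquare δ) (s : ZMod p) :
    ∃ r ∈ ({1, δ} : Set (ZMod p)), IsSquare (s * r) := by
  by_cases h : IsSquare s
  · exact ⟨1, by simp, by simpa⟩
  · refine ⟨δ, by simp, ?_⟩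
    have hp' : ringChar (ZMod p) ≠ 2 := by rwa [ZMod.ringChar_zmod_n]
    have h0 : s * δ ≠ 0 := by
      refine mul_ne_zero ?_ ?_ <;> rintro rfl
      exacts [h IsSquare.zero, hδ IsSquare.zero]
    rw [← quadraticChar_one_iff_isSquare h0, map_mul,
      quadraticChar_neg_one_iff_not_isSquare.2 h, quadraticChar_neg_one_iff_not_isSquare.2 hδ]
    rfl

theorem ne_zero_of_mem {δ s : ZMod p} (hδ : ¬IsSquare δ) (hs : s ∈ ({1, δ} : Set (ZMod p))) :
    s ≠ 0 := by
  rintro rfl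
  rcases hs with hs | hs
  · exact zero_ne_one hs
  · exact hδ (hs ▸ IsSquare.zero)

theorem exists_autConj_eq_rep16 (hp : p ≠ 2) {δ : ZMod p} (hδ : ¬IsSquare δ)
    {G : Subgroup (Equiv.Perm (Heisenberg p))} (hG : cond16 p G) :
    ∃ (α : MulAut (Heisenberg p)) (s : ZMod p) (t : ℕ),
      s ∈ ({1, δ} : Set (ZMod p)) ∧ t ∈ ({0, 1} : Set ℕ) ∧ autConj p α G = rep16 p hp s t := by
  obtain ⟨n, s, k, e₁, e₂, hs, rfl⟩ := exists_eq_autConj_std hp hG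
  obtain ⟨r, hr, x, hx⟩ := exists_isSquare_mul hp hδ s
  have hr0 := ne_zero_of_mem hδ hr
  have hx0 : x ≠ 0 := by
    rintro rfl
    simp [hs, hr0] at hx
  have hhalf : half p ≠ 0 := right_ne_zero_of_mul_eq_one (two_mul_half hp)
  obtain ⟨t, y, ht, hy, hty⟩ : ∃ (t : ℕ) (y : ZMod p), t ∈ ({0, 1} : Set ℕ) ∧ y ≠ 0 ∧
      k * (x * y) = t * r * half p ^ 2 := by
    by_cases hk : k = 0
    · exact ⟨0, 1, by simp, one_ne_zero, by simp [hk]⟩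
    · exact ⟨1, r * half p ^ 2 / (k * x), by simp, by simp [*], by simp; field_simp⟩
  obtain ⟨α, hα⟩ := autConj_std_diag hp hs hx0 hy k e₁ e₂
    (x * (-3 * t * half p ^ 2 - y * e₂)) (y * (x * e₁))
  refine ⟨α * (flagAut hp n)⁻¹, r, t, hr, ht, ?_⟩
  rw [← autConj_autConj, autConj_autConj _ (flagAut hp n), inv_mul_cancel, autConj_one, hα,
    rep16_eq_std hp hr0, hty]
  congr 1
  · field_simp
    linear_combination hx
  · field_simp
    ring
  · field_simp
    ring

theorem eq_of_autConj_rep16_eq (hp : p ≠ 2) {δ : ZMod p} (hδ : ¬IsSquare δ) {s s' : ZMod p}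
    (hs : s ∈ ({1, δ} : Set (ZMod p))) (hs' : s' ∈ ({1, δ} : Set (ZMod p))) {t t' : ℕ}
    (ht : t ∈ ({0, 1} : Set ℕ)) (ht' : t' ∈ ({0, 1} : Set ℕ)) {α : MulAut (Heisenberg p)}
    (h : autConj p α (rep16 p hp s t) = rep16 p hp s' t') : s = s' ∧ t = t' := by
  have hs0 := ne_zero_of_mem hδ hs
  have hs0' := ne_zero_of_mem hδ hs'
  have hhalf : half p ≠ 0 := right_ne_zero_of_mul_eq_one (two_mul_half hp)
  rw [rep16_eq_std hp hs0, rep16_eq_std hp hs0'] at h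
  obtain ⟨A, h₁, h₂, h₃, hdet, hA⟩ := exists_eq_toFun hp α
  obtain ⟨-, ha, h1, h2⟩ := invariants_of_autConj_std_eq hp (inv_ne_zero hs0) (inv_ne_zero hs0')
    hA h₁ h₂ h₃ hdet h
  field_simp at h1
  constructor
  · rcases hs with rfl | rfl <;> rcases hs' with rfl | rfl
    · rfl
    · exact (hδ ⟨A.a, by linear_combination h1⟩).elim
    · exact (hδ ⟨A.a⁻¹, by field_simp; linear_combination -h1⟩).elim
    · rfl
  · rcases ht with rfl | rfl <;> rcases ht' with rfl | rfl <;> simp_all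

theorem cond16_rep16 (hp : p ≠ 2) {δ : ZMod p} (hδ : ¬IsSquare δ) {s : ZMod p}
    (hs : s ∈ ({1, δ} : Set (ZMod p))) (t : ℕ) : cond16 p (rep16 p hp s t) := by
  have hs0 := ne_zero_of_mem hδ hs
  rw [rep16_eq_std hp hs0]
  exact cond16_std hp (inv_ne_zero hs0) _ _ _

theorem card_quot_cond16 (hp : p ≠ 2) {δ : ZMod p} (hδ : ¬IsSquare δ) :
    Nat.card (Quot (fun (G G' : {G : Subgroup (Equiv.Perm (Heisenberg p)) // cond16 p G}) =>
      ∃ α : MulAut (Heisenberg p), autConj p α G.1 = G'.1)) = 4 := by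
  let S : Setoid {G : Subgroup (Equiv.Perm (Heisenberg p)) // cond16 p G} :=
    { r := fun G G' => ∃ α : MulAut (Heisenberg p), autConj p α G.1 = G'.1
      iseqv :=
        { refl := fun G => ⟨1, autConj_one G.1⟩
          symm := fun ⟨α, h⟩ => ⟨α⁻¹, (autConj_eq_iff.1 h).symm⟩
          trans := fun ⟨α, h⟩ ⟨β, h'⟩ => ⟨β * α, by rw [← autConj_autConj, h, h']⟩ } }
  change Nat.card (Quotient S) = 4
  let f : ({1, δ} : Set (ZMod p)) × ({0, 1} : Set ℕ) → Quotient S := fun u =>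
    Quotient.mk S ⟨rep16 p hp u.1 u.2, cond16_rep16 hp hδ u.1.2 u.2⟩
  have hf : f.Bijective := by
    constructor
    · rintro ⟨⟨s, hs⟩, ⟨t, ht⟩⟩ ⟨⟨s', hs'⟩, ⟨t', ht'⟩⟩ h
      obtain ⟨α, h⟩ := Quotient.exact h
      obtain ⟨rfl, rfl⟩ := eq_of_autConj_rep16_eq hp hδ hs hs' ht ht' h
      rfl
    · rintro ⟨G, hG⟩
      obtain ⟨α, s, t, hs, ht, h⟩ := exists_autConj_eq_rep16 hp hδ hG
      exact ⟨⟨⟨s, hs⟩, ⟨t, ht⟩⟩, Quotient.sound ⟨α⁻¹, (autConj_eq_iff.1 h).symm⟩⟩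
  have h1 : (1 : ZMod p) ≠ δ := fun h => hδ (h ▸ IsSquare.one)
  rw [← Nat.card_eq_of_bijective f hf, Nat.card_prod, Nat.card_coe_set_eq, Nat.card_coe_set_eq,
    Set.ncard_pair h1, Set.ncard_pair zero_ne_one]

end Heisenberg

/-- Every regular subgroup of `Hol(M₁)` with `|Θ(G)| = p³` is isomorphic to
`M₁`; there are exactly `(p² − 1)p³` of them, forming exactly `4` conjugacy orbits, with
representatives `⟨τ⁻²α₁, ρˢτα₂, σ²τᵗα₃⟩` for `t ∈ {0, 1}` and `s ∈ {1, δ}`, `δ` a fixed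
non-square mod `p`. -/
theorem theta_p_cubed (p : ℕ) [Fact p.Prime] (h3 : 3 < p) (δ : ZMod p) (hδ : ¬IsSquare δ) :
    (∀ G, cond16 p G → Nonempty (G ≃* Heisenberg p)) ∧
    Nat.card {G : Subgroup (Equiv.Perm (Heisenberg p)) // cond16 p G} = (p ^ 2 - 1) * p ^ 3 ∧
    Nat.card (Quot (fun (G G' : {G : Subgroup (Equiv.Perm (Heisenberg p)) // cond16 p G}) =>
      ∃ α : MulAut (Heisenberg p), autConj p α G.1 = G'.1)) = 4 ∧
    (∀ s ∈ ({1, δ} : Set (ZMod p)), ∀ t ∈ ({0, 1} : Set ℕ),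
      cond16 p (rep16 p (by omega) s t)) ∧
    (∀ G, cond16 p G → ∃ (α : MulAut (Heisenberg p)) (s : ZMod p) (t : ℕ),
      s ∈ ({1, δ} : Set (ZMod p)) ∧ t ∈ ({0, 1} : Set ℕ) ∧
      autConj p α G = rep16 p (by omega) s t) ∧
    (∀ s ∈ ({1, δ} : Set (ZMod p)), ∀ s' ∈ ({1, δ} : Set (ZMod p)),
      ∀ t ∈ ({0, 1} : Set ℕ), ∀ t' ∈ ({0, 1} : Set ℕ),
      (∃ α : MulAut (Heisenberg p),
        autConj p α (rep16 p (by omega) s t) = rep16 p (by omega) s' t') →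
      s = s' ∧ t = t') := by
  have hp : p ≠ 2 := by omega
  exact ⟨fun _ hG => nonempty_mulEquiv_of_cond16 hp hG, card_cond16 hp, card_quot_cond16 hp hδ,
    fun _ hs t _ => cond16_rep16 hp hδ hs t, fun _ hG => exists_autConj_eq_rep16 hp hδ hG,
    fun _ hs _ hs' _ ht _ ht' ⟨_, h⟩ => eq_of_autConj_rep16_eq hp hδ hs hs' ht ht' h⟩
end

section
/- Let G be a finite group and let N be a regular subgroup of Perm(G) that is normalized by the image λ(G) of the left regular representation λ : G → Perm(G). Let φ : N → G be the bijection φ(n) = n(1_G), and define a binary operation ⊕ on G by g₁ ⊕ g₂ = φ(φ⁻¹(g₁) ∘ φ⁻¹(g₂)). Then (G, ⊕) is a group isomorphic to N, and the original multiplication ⊙ of G together with ⊕ satisfies the skew brace property: g₁ ⊙ (g₂ ⊕ g₃) = (g₁ ⊙ g₂) ⊖ g₁ ⊕ (g₁ ⊙ g₃) for all g₁, g₂, g₃ ∈ G, where ⊖g denotes the ⊕-inverse of g. In other words, (G, ⊕, ⊙) is a skew brace. -/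
/-- A bundled group structure on a carrier type `B`. -/
structure GroupStruct (B : Type*) where
  mul : B → B → B
  one : B
  inv : B → B
  mul_assoc : ∀ a b c, mul (mul a b) c = mul a (mul b c)
  one_mul : ∀ a, mul one a = a
  mul_one : ∀ a, mul a one = a
  inv_mul : ∀ a, mul (inv a) a = one
  mul_inv : ∀ a, mul a (inv a) = one

/-- A skew (left) brace: two group operations `⊕` (`addS`) and `⊙` (`mulS`) on the same set,
sharing the same identity element, related by the skew brace property
`a ⊙ (b ⊕ c) = (a ⊙ b) ⊖ a ⊕ (a ⊙ c)`. -/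
structure SkewBrace (B : Type*) where
  addS : GroupStruct B
  mulS : GroupStruct B
  same_one : addS.one = mulS.one
  compat : ∀ a b c, mulS.mul a (addS.mul b c) =
    addS.mul (addS.mul (mulS.mul a b) (addS.inv a)) (mulS.mul a c)

namespace SkewBrace

variable {B : Type*} (S : SkewBrace B)

/-- The permutation `d_a : b ↦ a ⊕ b` of the underlying set of a skew brace. -/
def dPerm (a : B) : Equiv.Perm B where
  toFun b := S.addS.mul a b
  invFun b := S.addS.mul (S.addS.inv a) b
  left_inv b := by dsimp only; rw [← S.addS.mul_assoc, S.addS.inv_mul, S.addS.one_mul]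
  right_inv b := by dsimp only; rw [← S.addS.mul_assoc, S.addS.mul_inv, S.addS.one_mul]

/-- The permutation `m_b : c ↦ b ⊙ c` (left translation for `⊙`). -/
def mPerm (b : B) : Equiv.Perm B where
  toFun c := S.mulS.mul b c
  invFun c := S.mulS.mul (S.mulS.inv b) c
  left_inv c := by dsimp only; rw [← S.mulS.mul_assoc, S.mulS.inv_mul, S.mulS.one_mul]
  right_inv c := by dsimp only; rw [← S.mulS.mul_assoc, S.mulS.mul_inv, S.mulS.one_mul]

end SkewBrace


/-- The group structure on `B` transported from a group `N` along a bijection `N ≃ B`. -/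
def GroupStruct.transport {N B : Type*} [Group N] (e : N ≃ B) : GroupStruct B where
  mul a b := e (e.symm a * e.symm b)
  one := e 1
  inv a := e (e.symm a)⁻¹
  mul_assoc a b c := by simp [_root_.mul_assoc]
  one_mul a := by simp
  mul_one a := by simp
  inv_mul a := by simp
  mul_inv a := by simp

/-- The group structure underlying a `Group` instance. -/
def GroupStruct.ofGroup (G : Type*) [Group G] : GroupStruct G where
  mul a b := a * b
  one := 1
  inv a := a⁻¹
  mul_assoc := _root_.mul_assoc
  one_mul := _root_.one_mul
  mul_one := _root_.mul_one
  inv_mul := inv_mul_cancel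
  mul_inv := mul_inv_cancel

/-- Evaluation at a point is a bijection from a regular permutation group to the set it acts on. -/
theorem bijective_eval_of_regular {X : Type*} (N : Subgroup (Equiv.Perm X))
    (hreg : ∀ x y : X, ∃! n : Equiv.Perm X, n ∈ N ∧ n x = y) (x : X) :
    Function.Bijective (fun n : N => (n : Equiv.Perm X) x) := by
  refine ⟨fun n m h => Subtype.ext ?_, fun y => ?_⟩
  · exact (hreg x ((m : Equiv.Perm X) x)).unique ⟨n.2, h⟩ ⟨m.2, rfl⟩
  · obtain ⟨n, ⟨hn, hy⟩, -⟩ := hreg x y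
    exact ⟨⟨n, hn⟩, hy⟩

/-- Let `N` be a regular subgroup of `Perm(G)` normalized by the image of the
left regular representation of the finite group `G`. Then evaluation at `1` is a bijection
`N → G`, and transporting the group structure of `N` along it yields an operation `⊕` making
`(G, ⊕, ⊙)` a skew brace (where `⊙` is the original multiplication of `G`), with `(G, ⊕)`
isomorphic to `N` via the evaluation map. -/
theorem regular_normalized_subgroup_gives_skew_brace {G : Type*} [Group G] [Finite G]
    (N : Subgroup (Equiv.Perm G))
    (hreg : ∀ x y : G, ∃! n : Equiv.Perm G, n ∈ N ∧ n x = y)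
    (hnorm : ∀ g : G, ∀ n ∈ N, Equiv.mulLeft g * n * (Equiv.mulLeft g)⁻¹ ∈ N) :
    Function.Bijective (fun n : N => (n : Equiv.Perm G) (1 : G)) ∧
    ∃ S : SkewBrace G,
      (∀ a b : G, S.mulS.mul a b = a * b) ∧
      (∀ n m : N, S.addS.mul ((n : Equiv.Perm G) 1) ((m : Equiv.Perm G) 1) =
        ((↑(n * m) : Equiv.Perm G) 1)) := by
  have hbij := bijective_eval_of_regular N hreg 1
  refine ⟨hbij, ?_⟩
  let e : N ≃ G := Equiv.ofBijective _ hbij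
  have he (n : N) : e n = (n : Equiv.Perm G) 1 := rfl
  have hsymm (a : G) : (e.symm a : Equiv.Perm G) 1 = a := e.apply_symm_apply a
  refine ⟨⟨GroupStruct.transport e, GroupStruct.ofGroup G, rfl, fun a b c => ?_⟩,
    fun _ _ => rfl, fun n m => ?_⟩
  · let n' : N := ⟨_, hnorm a _ (e.symm b).2⟩
    have hn' (x : G) : (n' : Equiv.Perm G) (a * x) = a * (e.symm b : Equiv.Perm G) x := by
      simp [n']
    have key : n' * e.symm a = e.symm (a * b) := by
      apply e.injective
      have h := hn' 1
      rw [mul_one, hsymm] at h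
      simp [he, hsymm, h]
    simp only [GroupStruct.transport, GroupStruct.ofGroup, Equiv.symm_apply_apply, ← key,
      mul_inv_cancel_right]
    simp [he, hsymm, hn']
  · simp only [← he, GroupStruct.transport, Equiv.symm_apply_apply]
end
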